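/- arXiv:1705.02134 — 3 statements merged into one kernel-verified Lean document; each statement's English description precedes it below -/
import Mathlib

section
/- Let n ≥ 1 and let N be a positive integer with N ≡ 3 (mod 4). Let H be a symmetric matrix in GL(n,ℤ) with H² = 1, and let U(H) = {g ∈ GL(n,ℂ) : g^†Hg = H}. Every g ∈ U(H) can be written uniquely as g = X + αY with X, Y real n×n matrices and α = (−1 + i√N)/2, and the map ρ sending g = X + αY to the real 2n×2n block matrix ρ(g) = [[X, ((N+1)/4)·YH], [−HY, H(X−Y)H]] is an injective group homomorphism from U(H) into the symplectic group Sp(n,ℝ) = {g ∈ GL(2n,ℝ) : gᵀJg = J}, J = [[0, 1],[−1, 0]] (block form), whose image is exactly {g ∈ Sp(n,ℝ) : σ(g)·J_N = J_N·σ(g)}, where σ([[A,B],[C,D]]) = [[A,−B],[−C,D]] and J_N = [[0, −((N+1)/4)H],[H, −1]] (block form). -/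
noncomputable section

open Matrix

/-- `α = (−1 + i√N)/2`. -/
def alphaN (N : ℕ) : ℂ := (-1 + Complex.I * (Real.sqrt N : ℂ)) / 2

/-- The real matrix `Y` with `g = X + αY`, namely `Y = (2/√N)·Im(g)`. -/
def Yof (N : ℕ) {n : ℕ} (g : Matrix (Fin n) (Fin n) ℂ) : Matrix (Fin n) (Fin n) ℝ :=
  (2 / Real.sqrt N) • g.map Complex.im

/-- The real matrix `X` with `g = X + αY`, namely `X = Re(g) + Y/2`. -/
def Xof (N : ℕ) {n : ℕ} (g : Matrix (Fin n) (Fin n) ℂ) : Matrix (Fin n) (Fin n) ℝ :=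
  g.map Complex.re + ((1 : ℝ) / 2) • Yof N g

/-- The standard embedding `ρ(X + αY) = [[X, ((N+1)/4)·YH], [−HY, H(X−Y)H]]`. -/
def rho (N : ℕ) {n : ℕ} (H : Matrix (Fin n) (Fin n) ℝ) (g : Matrix (Fin n) (Fin n) ℂ) :
    Matrix (Fin n ⊕ Fin n) (Fin n ⊕ Fin n) ℝ :=
  Matrix.fromBlocks (Xof N g) ((((N : ℝ) + 1) / 4) • (Yof N g * H))
    (-(H * Yof N g)) (H * (Xof N g - Yof N g) * H)

/-- The standard symplectic form `J = [[0, 1], [−1, 0]]`. -/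
def Jstd (n : ℕ) : Matrix (Fin n ⊕ Fin n) (Fin n ⊕ Fin n) ℝ :=
  Matrix.fromBlocks 0 1 (-1) 0

/-- Membership in the symplectic group `Sp(n, ℝ)`: `gᵀJg = J`. -/
def InSp {n : ℕ} (m : Matrix (Fin n ⊕ Fin n) (Fin n ⊕ Fin n) ℝ) : Prop :=
  mᵀ * Jstd n * m = Jstd n

/-- Membership in the unitary group `U(H)`: `g†Hg = H`. -/
def InUH {n : ℕ} (H : Matrix (Fin n) (Fin n) ℝ) (g : Matrix (Fin n) (Fin n) ℂ) : Prop :=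
  gᴴ * H.map (Complex.ofReal) * g = H.map (Complex.ofReal)

/-- The involutive automorphism `σ([[A,B],[C,D]]) = [[A,−B],[−C,D]]`. -/
def sigmaBlocks {n : ℕ} (m : Matrix (Fin n ⊕ Fin n) (Fin n ⊕ Fin n) ℝ) :
    Matrix (Fin n ⊕ Fin n) (Fin n ⊕ Fin n) ℝ :=
  Matrix.fromBlocks (m.toBlocks₁₁) (-(m.toBlocks₁₂)) (-(m.toBlocks₂₁)) (m.toBlocks₂₂)

/-- The matrix `J_N = [[0, −((N+1)/4)H], [H, −1]]` representing multiplication by `α`. -/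
def JN (N : ℕ) {n : ℕ} (H : Matrix (Fin n) (Fin n) ℝ) :
    Matrix (Fin n ⊕ Fin n) (Fin n ⊕ Fin n) ℝ :=
  Matrix.fromBlocks 0 ((-(((N : ℝ) + 1) / 4)) • H) H (-1)

/-- The complex matrix `X + αY`. -/
def ofRealPair (N : ℕ) {n : ℕ} (X Y : Matrix (Fin n) (Fin n) ℝ) : Matrix (Fin n) (Fin n) ℂ :=
  X.map Complex.ofReal + alphaN N • Y.map Complex.ofReal

lemma alphaN_re (N : ℕ) : (alphaN N).re = -1 / 2 := by
  simp [alphaN]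

lemma alphaN_im (N : ℕ) : (alphaN N).im = Real.sqrt N / 2 := by
  simp [alphaN]

lemma alphaN_mul_self (N : ℕ) :
    alphaN N * alphaN N = -alphaN N - ((((N : ℝ) + 1) / 4 : ℝ) : ℂ) := by
  have h : Real.sqrt N * Real.sqrt N = N := Real.mul_self_sqrt (Nat.cast_nonneg N)
  apply Complex.ext
  · rw [Complex.mul_re, Complex.sub_re, Complex.neg_re, Complex.ofReal_re, alphaN_re, alphaN_im]
    linarith
  · rw [Complex.mul_im, Complex.sub_im, Complex.neg_im, Complex.ofReal_im, alphaN_re, alphaN_im]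
    ring

lemma star_alphaN (N : ℕ) : star (alphaN N) = -1 - alphaN N := by
  apply Complex.ext
  · simp [alphaN_re]; norm_num
  · simp

lemma Yof_ofRealPair {N : ℕ} (hN : 0 < N) {n : ℕ} (X Y : Matrix (Fin n) (Fin n) ℝ) :
    Yof N (ofRealPair N X Y) = Y := by
  have h : Real.sqrt N ≠ 0 := (Real.sqrt_pos.mpr (Nat.cast_pos.mpr hN)).ne'
  ext i j
  simp [Yof, ofRealPair, alphaN_im]
  field_simp

lemma Xof_ofRealPair {N : ℕ} (hN : 0 < N) {n : ℕ} (X Y : Matrix (Fin n) (Fin n) ℝ) :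
    Xof N (ofRealPair N X Y) = X := by
  rw [Xof, Yof_ofRealPair hN]
  ext i j
  simp [ofRealPair, alphaN_re]
  ring

lemma ofRealPair_Xof_Yof {N : ℕ} (hN : 0 < N) {n : ℕ} (g : Matrix (Fin n) (Fin n) ℂ) :
    ofRealPair N (Xof N g) (Yof N g) = g := by
  have h : Real.sqrt N ≠ 0 := (Real.sqrt_pos.mpr (Nat.cast_pos.mpr hN)).ne'
  ext i j
  apply Complex.ext
  · simp [Xof, Yof, ofRealPair, alphaN_re]
    ring
  · simp [Xof, Yof, ofRealPair, alphaN_im]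
    field_simp

lemma ofRealPair_inj {N : ℕ} (hN : 0 < N) {n : ℕ} {X Y X' Y' : Matrix (Fin n) (Fin n) ℝ} :
    ofRealPair N X Y = ofRealPair N X' Y' ↔ X = X' ∧ Y = Y' := by
  refine ⟨fun h => ⟨?_, ?_⟩, fun h => by rw [h.1, h.2]⟩
  · rw [← Xof_ofRealPair hN X Y, h, Xof_ofRealPair hN]
  · rw [← Yof_ofRealPair hN X Y, h, Yof_ofRealPair hN]

lemma ofRealPair_mul (N : ℕ) {n : ℕ} (X Y X' Y' : Matrix (Fin n) (Fin n) ℝ) :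
    ofRealPair N X Y * ofRealPair N X' Y' =
      ofRealPair N (X * X' - (((N : ℝ) + 1) / 4) • (Y * Y')) (X * Y' + Y * X' - Y * Y') := by
  have hm (A B : Matrix (Fin n) (Fin n) ℝ) :
      (A * B).map Complex.ofReal = A.map Complex.ofReal * B.map Complex.ofReal :=
    Matrix.map_mul (f := Complex.ofRealHom)
  have hs (c : ℝ) (A : Matrix (Fin n) (Fin n) ℝ) :
      (c • A).map Complex.ofReal = (c : ℂ) • A.map Complex.ofReal := by
    ext i j; simp
  have ha (A B : Matrix (Fin n) (Fin n) ℝ) :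
      (A + B).map Complex.ofReal = A.map Complex.ofReal + B.map Complex.ofReal := by
    ext i j; simp
  have hd (A B : Matrix (Fin n) (Fin n) ℝ) :
      (A - B).map Complex.ofReal = A.map Complex.ofReal - B.map Complex.ofReal := by
    ext i j; simp
  simp only [ofRealPair, hm, hs, ha, hd, add_mul, mul_add, Matrix.smul_mul, Matrix.mul_smul,
    smul_smul, alphaN_mul_self]
  module

lemma ofRealPair_conjTranspose (N : ℕ) {n : ℕ} (X Y : Matrix (Fin n) (Fin n) ℝ) :
    (ofRealPair N X Y)ᴴ = ofRealPair N (Xᵀ - Yᵀ) (-Yᵀ) := by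
  ext i j
  have h := star_alphaN N
  simp only [Complex.star_def] at h
  simp [ofRealPair, h]
  ring

lemma inUH_ofRealPair_iff {N : ℕ} (hN : 0 < N) {n : ℕ} (H X Y : Matrix (Fin n) (Fin n) ℝ) :
    InUH H (ofRealPair N X Y) ↔
      Xᵀ * H * Y = Yᵀ * H * X ∧
        Xᵀ * H * X - Xᵀ * H * Y + (((N : ℝ) + 1) / 4) • (Yᵀ * H * Y) = H := by
  have hH : H.map Complex.ofReal = ofRealPair N H 0 := by
    ext i j; simp [ofRealPair]
  rw [InUH, hH, ofRealPair_conjTranspose, ofRealPair_mul, ofRealPair_mul, ofRealPair_inj hN]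
  simp only [Matrix.mul_zero, smul_zero, sub_zero, zero_add, Matrix.sub_mul, Matrix.neg_mul]
  constructor
  · rintro ⟨h₁, h₂⟩
    have h : Xᵀ * H * Y = Yᵀ * H * X := by
      rw [← sub_eq_zero, ← h₂]; abel
    refine ⟨h, ?_⟩
    rw [h]
    nth_rewrite 4 [← h₁]
    module
  · rintro ⟨h₁, h₂⟩
    refine ⟨?_, ?_⟩
    · rw [← h₁]
      nth_rewrite 4 [← h₂]
      module
    · rw [h₁]; abel

lemma inSp_fromBlocks_iff {n : ℕ} (A B C D : Matrix (Fin n) (Fin n) ℝ) :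
    InSp (fromBlocks A B C D) ↔
      Aᵀ * C = Cᵀ * A ∧ Bᵀ * D = Dᵀ * B ∧ Aᵀ * D - Cᵀ * B = 1 := by
  rw [InSp, Jstd, fromBlocks_transpose, fromBlocks_multiply, fromBlocks_multiply,
    fromBlocks_inj]
  simp only [Matrix.mul_zero, Matrix.mul_one, Matrix.mul_neg, Matrix.neg_mul, zero_add,
    add_zero, neg_add_eq_sub, sub_eq_zero]
  refine ⟨fun ⟨h₁, h₂, _, h₄⟩ => ⟨h₁, h₄, h₂⟩, fun ⟨h₁, h₂, h₃⟩ => ⟨h₁, h₃, ?_, h₂⟩⟩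
  rw [← h₃]
  have := congrArg Matrix.transpose h₃
  simp only [transpose_sub, transpose_mul, transpose_transpose, transpose_one] at this
  rw [h₃, ← this]
  abel

/-- The real conditions expressing `X + αY ∈ U(H)` say that `ρ(X + αY)` is symplectic. -/
lemma inSp_blocks_iff {n : ℕ} {H : Matrix (Fin n) (Fin n) ℝ} (hHsym : Hᵀ = H)
    (hHsq : H * H = 1) (c : ℝ) (X Y : Matrix (Fin n) (Fin n) ℝ) :
    InSp (fromBlocks X (c • (Y * H)) (-(H * Y)) (H * (X - Y) * H)) ↔
      Xᵀ * H * Y = Yᵀ * H * X ∧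
        Xᵀ * H * X - Xᵀ * H * Y + c • (Yᵀ * H * Y) = H := by
  have hc (A B : Matrix (Fin n) (Fin n) ℝ) : A * H = B * H ↔ A = B := by
    refine ⟨fun h => ?_, fun h => by rw [h]⟩
    rw [← Matrix.mul_one A, ← hHsq, ← Matrix.mul_assoc, h, Matrix.mul_assoc, hHsq, Matrix.mul_one]
  have h₃ : Xᵀ * (H * (X - Y) * H) - (-(H * Y))ᵀ * (c • (Y * H)) =
      (Xᵀ * H * X - Xᵀ * H * Y + c • (Yᵀ * H * Y)) * H := by
    simp only [transpose_neg, transpose_mul, hHsym, Matrix.mul_smul, Matrix.smul_mul,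
      Matrix.neg_mul, Matrix.mul_sub, Matrix.sub_mul, Matrix.add_mul, Matrix.mul_assoc]
    module
  rw [inSp_fromBlocks_iff, h₃, ← hHsq, hc]
  simp only [transpose_neg, transpose_mul, transpose_smul, transpose_sub, hHsym, Matrix.mul_neg,
    Matrix.neg_mul, neg_inj, ← Matrix.mul_assoc]
  refine ⟨fun h => ⟨h.1, h.2.2⟩, fun h => ⟨h.1, ?_, h.2⟩⟩
  have h' : Yᵀ * (H * X) = Xᵀ * (H * Y) := by simpa only [Matrix.mul_assoc] using h.1.symm
  have e₁ : H * (Yᵀ * (H * (X * H))) = H * (Xᵀ * (H * (Y * H))) := by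
    simp only [← Matrix.mul_assoc] at h' ⊢
    rw [Matrix.mul_assoc H Yᵀ H, Matrix.mul_assoc H (Yᵀ * H) X, h']
    simp only [Matrix.mul_assoc]
  simp only [Matrix.smul_mul, Matrix.mul_smul, Matrix.mul_sub, Matrix.sub_mul, Matrix.mul_assoc,
    e₁, smul_sub]

lemma rho_ofRealPair {N : ℕ} (hN : 0 < N) {n : ℕ} (H X Y : Matrix (Fin n) (Fin n) ℝ) :
    rho N H (ofRealPair N X Y) =
      fromBlocks X ((((N : ℝ) + 1) / 4) • (Y * H)) (-(H * Y)) (H * (X - Y) * H) := by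
  rw [rho, Xof_ofRealPair hN, Yof_ofRealPair hN]

lemma inSp_rho_iff {N : ℕ} (hN : 0 < N) {n : ℕ} {H : Matrix (Fin n) (Fin n) ℝ}
    (hHsym : Hᵀ = H) (hHsq : H * H = 1) (g : Matrix (Fin n) (Fin n) ℂ) :
    InSp (rho N H g) ↔ InUH H g := by
  rw [← ofRealPair_Xof_Yof hN g, rho_ofRealPair hN, inSp_blocks_iff hHsym hHsq,
    inUH_ofRealPair_iff hN]

lemma rho_mul {N : ℕ} (hN : 0 < N) {n : ℕ} {H : Matrix (Fin n) (Fin n) ℝ}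
    (hHsq : H * H = 1) (g₁ g₂ : Matrix (Fin n) (Fin n) ℂ) :
    rho N H (g₁ * g₂) = rho N H g₁ * rho N H g₂ := by
  have hc (A : Matrix (Fin n) (Fin n) ℝ) : H * (H * A) = A := by
    rw [← Matrix.mul_assoc, hHsq, Matrix.one_mul]
  rw [← ofRealPair_Xof_Yof hN g₁, ← ofRealPair_Xof_Yof hN g₂, ofRealPair_mul,
    rho_ofRealPair hN, rho_ofRealPair hN, rho_ofRealPair hN, fromBlocks_multiply, fromBlocks_inj]
  simp only [Matrix.mul_neg, Matrix.neg_mul, Matrix.smul_mul, Matrix.mul_smul, Matrix.mul_add,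
    Matrix.add_mul, Matrix.mul_sub, Matrix.sub_mul, Matrix.mul_assoc, hc]
  refine ⟨?_, ?_, ?_, ?_⟩ <;> module

lemma rho_injective {N : ℕ} (hN : 0 < N) {n : ℕ} {H : Matrix (Fin n) (Fin n) ℝ}
    (hHsq : H * H = 1) : Function.Injective (rho N (n := n) H) := by
  intro g₁ g₂ h
  rw [rho, rho, fromBlocks_inj, neg_inj] at h
  have hY : Yof N g₁ = Yof N g₂ := by
    rw [← Matrix.one_mul (Yof N g₁), ← hHsq, Matrix.mul_assoc, h.2.2.1, ← Matrix.mul_assoc, hHsq,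
      Matrix.one_mul]
  rw [← ofRealPair_Xof_Yof hN g₁, h.1, hY, ofRealPair_Xof_Yof hN]

lemma sigmaBlocks_commute_iff {N : ℕ} (hN : 0 < N) {n : ℕ} {H : Matrix (Fin n) (Fin n) ℝ}
    (hHsq : H * H = 1) (m : Matrix (Fin n ⊕ Fin n) (Fin n ⊕ Fin n) ℝ) :
    sigmaBlocks m * JN N H = JN N H * sigmaBlocks m ↔ ∃ g, rho N H g = m := by
  have hc (A : Matrix (Fin n) (Fin n) ℝ) : H * (H * A) = A := by
    rw [← Matrix.mul_assoc, hHsq, Matrix.one_mul]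
  constructor
  · intro h
    obtain ⟨A, B, C, D, rfl⟩ : ∃ A B C D, m = fromBlocks A B C D :=
      ⟨_, _, _, _, (fromBlocks_toBlocks m).symm⟩
    rw [sigmaBlocks, JN, fromBlocks_multiply, fromBlocks_multiply, fromBlocks_inj] at h
    simp only [toBlocks_fromBlocks₁₁, toBlocks_fromBlocks₁₂, toBlocks_fromBlocks₂₁,
      toBlocks_fromBlocks₂₂, Matrix.mul_zero, Matrix.zero_mul, zero_add, Matrix.neg_mul,
      Matrix.mul_neg, Matrix.smul_mul, neg_smul, neg_neg, Matrix.one_mul] at h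
    obtain ⟨h₁, -, h₃, -⟩ := h
    refine ⟨ofRealPair N A (-(H * C)), ?_⟩
    rw [rho_ofRealPair hN, fromBlocks_inj]
    refine ⟨rfl, ?_, ?_, ?_⟩
    · rw [← Matrix.mul_one B, ← hHsq, ← Matrix.mul_assoc, ← neg_neg (B * H), h₁]
      simp only [Matrix.neg_mul, Matrix.smul_mul, smul_neg]
    · simp only [Matrix.mul_neg, neg_neg, hc]
    · rw [← Matrix.mul_one D, ← hHsq, ← Matrix.mul_assoc, h₃]
      simp only [sub_neg_eq_add, Matrix.mul_add, hc]
  · rintro ⟨g, rfl⟩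
    rw [sigmaBlocks, JN, rho, fromBlocks_multiply, fromBlocks_multiply, fromBlocks_inj]
    simp only [toBlocks_fromBlocks₁₁, toBlocks_fromBlocks₁₂, toBlocks_fromBlocks₂₁,
      toBlocks_fromBlocks₂₂, Matrix.mul_zero, Matrix.zero_mul, zero_add, Matrix.neg_mul,
      Matrix.mul_neg, Matrix.smul_mul, Matrix.mul_smul, neg_smul, neg_neg, Matrix.one_mul,
      Matrix.mul_one, Matrix.mul_sub, Matrix.sub_mul, Matrix.mul_assoc, hHsq, hc]
    refine ⟨?_, ?_, ?_, ?_⟩ <;> first | trivial | module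

/-- Every `g ∈ U(H)` decomposes uniquely as `g = X + αY` with `X, Y` real, and
`ρ : U(H) → Sp(n,ℝ)` is an injective group homomorphism with image
`{g ∈ Sp(n,ℝ) : σ(g)J_N = J_N σ(g)}`. -/
theorem statement11
    (n : ℕ) (hn : 1 ≤ n) (N : ℕ) (hN : N % 4 = 3)
    (H : Matrix (Fin n) (Fin n) ℝ)
    (hHint : ∀ i j, ∃ m : ℤ, H i j = (m : ℝ))
    (hHsym : Hᵀ = H) (hHsq : H * H = 1) :
    (∀ g : Matrix (Fin n) (Fin n) ℂ, InUH H g →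
      ∃! XY : Matrix (Fin n) (Fin n) ℝ × Matrix (Fin n) (Fin n) ℝ,
        g = XY.1.map (Complex.ofReal) + alphaN N • XY.2.map (Complex.ofReal)) ∧
    (∀ g : Matrix (Fin n) (Fin n) ℂ, InUH H g → InSp (rho N H g)) ∧
    (∀ g₁ g₂ : Matrix (Fin n) (Fin n) ℂ, InUH H g₁ → InUH H g₂ →
      rho N H (g₁ * g₂) = rho N H g₁ * rho N H g₂) ∧
    (∀ g₁ g₂ : Matrix (Fin n) (Fin n) ℂ, InUH H g₁ → InUH H g₂ →
      rho N H g₁ = rho N H g₂ → g₁ = g₂) ∧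
    (∀ m : Matrix (Fin n ⊕ Fin n) (Fin n ⊕ Fin n) ℝ,
      (InSp m ∧ sigmaBlocks m * JN N H = JN N H * sigmaBlocks m) ↔
        ∃ g : Matrix (Fin n) (Fin n) ℂ, InUH H g ∧ rho N H g = m) := by
  have hN' : 0 < N := by omega
  refine ⟨fun g _ => ⟨(Xof N g, Yof N g), (ofRealPair_Xof_Yof hN' g).symm, ?_⟩,
    fun g hg => (inSp_rho_iff hN' hHsym hHsq g).mpr hg, fun g₁ g₂ _ _ => rho_mul hN' hHsq g₁ g₂,
    fun g₁ g₂ _ _ h => rho_injective hN' hHsq h, fun m => ?_⟩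
  · rintro ⟨X, Y⟩ h
    obtain rfl : g = ofRealPair N X Y := h
    rw [Xof_ofRealPair hN', Yof_ofRealPair hN']
  · rw [sigmaBlocks_commute_iff hN' hHsq]
    constructor
    · rintro ⟨h, g, rfl⟩
      exact ⟨g, (inSp_rho_iff hN' hHsym hHsq g).mp h, rfl⟩
    · rintro ⟨g, hg, rfl⟩
      exact ⟨(inSp_rho_iff hN' hHsym hHsq g).mpr hg, g, rfl⟩
end
end

section
/- The principal congruence subgroup of level √−3 of the unitary group of the hyperbolic hermitian lattice over the Eisenstein integers, U(H₂;𝒪)[√−3], is isomorphic as a group to the direct product Γ₁(3) × C₃ of the congruence subgroup Γ₁(3) ⊂ SL(2,ℤ) with a cyclic group of order three (the isomorphism onto Γ₁(3) being realized by conjugation with g₀ = diag(1/√−3, 1) ∈ GL(2,ℚ(ζ₃))). -/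
noncomputable section

open Matrix

/-- The Eisenstein integers `𝒪 = ℤ[ζ₃]`, as a subring of `ℂ` generated by
`ζ₃ = (−1 + i√3)/2`. -/
def EisensteinInt : Subring ℂ :=
  Subring.closure {(-1 + Complex.I * (Real.sqrt 3 : ℂ)) / 2}

/-- The hyperbolic hermitian form `H₂`. -/
def H2c : Matrix (Fin 2) (Fin 2) ℂ := !![0, 1; 1, 0]

/-- Membership in the principal congruence subgroup `U(H₂;𝒪)[√−3]`: entries in `𝒪`,
isometry of `H₂`, and congruent to the identity modulo `√−3 = i√3`. -/
def InUH2Level (g : Matrix (Fin 2) (Fin 2) ℂ) : Prop :=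
  (∀ i j, g i j ∈ EisensteinInt) ∧
  gᴴ * H2c * g = H2c ∧
  (∀ i j, ∃ o ∈ EisensteinInt,
    g i j - (1 : Matrix (Fin 2) (Fin 2) ℂ) i j = Complex.I * (Real.sqrt 3 : ℂ) * o)

namespace EisensteinUnitary

/-- The primitive cube root of unity `ζ₃`. -/
def omega : ℂ := (-1 + Complex.I * (Real.sqrt 3 : ℂ)) / 2

/-- The square root `√−3`. -/
def sqrtNegThree : ℂ := Complex.I * (Real.sqrt 3 : ℂ)

lemma sqrtNegThree_mul_self : sqrtNegThree * sqrtNegThree = -3 := by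
  have h : ((Real.sqrt 3 : ℝ) : ℂ) * (Real.sqrt 3 : ℝ) = 3 := by
    rw [← Complex.ofReal_mul, Real.mul_self_sqrt (by norm_num)]
    norm_num
  unfold sqrtNegThree
  linear_combination (Real.sqrt 3 : ℂ) * (Real.sqrt 3 : ℂ) * Complex.I_mul_I - h

lemma sqrtNegThree_ne_zero : sqrtNegThree ≠ 0 := by
  intro h
  simpa [h] using sqrtNegThree_mul_self

lemma two_mul_omega : 2 * omega = -1 + sqrtNegThree := by
  unfold omega sqrtNegThree
  ring

lemma star_sqrtNegThree : star sqrtNegThree = -sqrtNegThree := by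
  simp [sqrtNegThree]

lemma omega_sq : omega ^ 2 = -1 - omega := by
  linear_combination (1 / 4 : ℂ) * (2 * omega + 1 + sqrtNegThree) * two_mul_omega
    + (1 / 4 : ℂ) * sqrtNegThree_mul_self

lemma omega_pow_three : omega ^ 3 = 1 := by
  linear_combination (omega - 1) * omega_sq

lemma omega_pow_pow_three (n : ℕ) : (omega ^ n) ^ 3 = 1 := by
  rw [pow_right_comm, omega_pow_three, one_pow]

lemma star_omega : star omega = -1 - omega := by
  have h : 2 * star omega = -1 - sqrtNegThree := by
    have := congrArg star two_mul_omega
    simp only [star_mul', star_add, star_neg, star_one, star_sqrtNegThree, star_ofNat] at this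
    linear_combination this
  linear_combination (1 / 2 : ℂ) * h + (1 / 2 : ℂ) * two_mul_omega

lemma star_omega_mul_omega : star omega * omega = 1 := by
  rw [star_omega]
  linear_combination -omega_sq

lemma omega_mem : omega ∈ EisensteinInt := Subring.subset_closure rfl

lemma sqrtNegThree_mem : sqrtNegThree ∈ EisensteinInt := by
  have h : sqrtNegThree = omega + omega + 1 := by linear_combination -two_mul_omega
  rw [h]
  exact add_mem (add_mem omega_mem omega_mem) (one_mem _)

lemma omega_re : omega.re = -1 / 2 := by
  simp [omega]

lemma omega_im : omega.im = Real.sqrt 3 / 2 := by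
  simp [omega]

lemma omega_ne_one : omega ≠ 1 := by
  intro h
  have := omega_re
  rw [h] at this
  norm_num at this

lemma isPrimitiveRoot_omega : IsPrimitiveRoot omega 3 :=
  have : Fact (Nat.Prime 3) := ⟨Nat.prime_three⟩
  IsPrimitiveRoot.iff_orderOf.mpr (orderOf_eq_prime omega_pow_three omega_ne_one)

lemma omega_pow_mod (n : ℕ) : omega ^ (n % 3) = omega ^ n :=
  (pow_eq_pow_mod n omega_pow_three).symm

lemma exists_int_of_mem {z : ℂ} (hz : z ∈ EisensteinInt) :
    ∃ m n : ℤ, z = m + n * omega := by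
  induction hz using Subring.closure_induction with
  | mem x hx => exact ⟨0, 1, by rw [Set.mem_singleton_iff.mp hx]; simp [omega]⟩
  | zero => exact ⟨0, 0, by simp⟩
  | one => exact ⟨1, 0, by simp⟩
  | add x y _ _ hx hy =>
    obtain ⟨m, n, rfl⟩ := hx
    obtain ⟨m', n', rfl⟩ := hy
    exact ⟨m + m', n + n', by push_cast; ring⟩
  | neg x _ hx =>
    obtain ⟨m, n, rfl⟩ := hx
    exact ⟨-m, -n, by push_cast; ring⟩
  | mul x y _ _ hx hy =>
    obtain ⟨m, n, rfl⟩ := hx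
    obtain ⟨m', n', rfl⟩ := hy
    refine ⟨m * m' - n * n', m * n' + n * m' - n * n', ?_⟩
    push_cast
    linear_combination (n * n' : ℂ) * omega_sq

lemma int_add_int_mul_omega_inj {m n m' n' : ℤ}
    (h : (m + n * omega : ℂ) = m' + n' * omega) : m = m' ∧ n = n' := by
  have hre := congrArg Complex.re h
  have him := congrArg Complex.im h
  have h3 : Real.sqrt 3 ≠ 0 := by positivity
  simp only [Complex.add_re, Complex.mul_re, Complex.intCast_re, Complex.intCast_im, omega_re,
    zero_mul, sub_zero] at hre
  simp only [Complex.add_im, Complex.mul_im, Complex.intCast_re, Complex.intCast_im, omega_im,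
    zero_mul, zero_add, add_zero] at him
  have hn : (n : ℝ) = n' := mul_right_cancel₀ (div_ne_zero h3 two_ne_zero) him
  have hm : (m : ℝ) = m' := by rw [hn] at hre; linarith
  exact ⟨by exact_mod_cast hm, by exact_mod_cast hn⟩

lemma exists_int_of_mem_of_star_eq {z : ℂ} (hz : z ∈ EisensteinInt) (h : star z = z) :
    ∃ m : ℤ, z = m := by
  obtain ⟨m, n, rfl⟩ := exists_int_of_mem hz
  have key : ((m - n : ℤ) + (-n : ℤ) * omega : ℂ) = m + n * omega := by
    rw [← h]
    simp only [star_add, star_mul', star_omega, star_intCast]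
    push_cast
    ring
  obtain ⟨-, hn⟩ := int_add_int_mul_omega_inj key
  obtain rfl : n = 0 := by lia
  exact ⟨m, by simp⟩

/-- Congruence to `1` modulo `√−3` of `m + n ζ₃` reads `m + n ≡ 1` modulo `3`. -/
lemma int_add_emod_three {m n : ℤ} {o : ℂ} (ho : o ∈ EisensteinInt)
    (h : (m + n * omega : ℂ) - 1 = sqrtNegThree * o) : (m + n) % 3 = 1 := by
  obtain ⟨x, y, rfl⟩ := exists_int_of_mem ho
  have key : (m + n * omega : ℂ) = (1 + x - 2 * y : ℤ) + (2 * x - y : ℤ) * omega := by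
    push_cast
    linear_combination h - (x + y * omega : ℂ) * two_mul_omega + 2 * (y : ℂ) * omega_sq
  obtain ⟨h1, h2⟩ := int_add_int_mul_omega_inj key
  lia

lemma eq_omega_pow {z o : ℂ} (hz : z ∈ EisensteinInt) (hu : star z * z = 1)
    (ho : o ∈ EisensteinInt) (h : z - 1 = sqrtNegThree * o) : ∃ j : ℕ, z = omega ^ j := by
  obtain ⟨m, n, rfl⟩ := exists_int_of_mem hz
  have hmod := int_add_emod_three ho h
  have key : ((m * m - m * n + n * n : ℤ) + (0 : ℤ) * omega : ℂ) = (1 : ℤ) + (0 : ℤ) * omega := by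
    simp only [star_add, star_mul', star_omega, star_intCast] at hu
    push_cast
    linear_combination hu + (n * n : ℂ) * omega_sq
  obtain ⟨hN, -⟩ := int_add_int_mul_omega_inj key
  have hm1 : m ≤ 1 := by nlinarith [sq_nonneg (m - 2 * n)]
  have hm2 : -1 ≤ m := by nlinarith [sq_nonneg (m - 2 * n)]
  have hn1 : n ≤ 1 := by nlinarith [sq_nonneg (n - 2 * m)]
  have hn2 : -1 ≤ n := by nlinarith [sq_nonneg (n - 2 * m)]
  have hcases : (m = 1 ∧ n = 0) ∨ (m = 0 ∧ n = 1) ∨ (m = -1 ∧ n = -1) := by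
    interval_cases m <;> interval_cases n <;> simp_all
  obtain ⟨rfl, rfl⟩ | ⟨rfl, rfl⟩ | ⟨rfl, rfl⟩ := hcases
  · exact ⟨0, by simp⟩
  · exact ⟨1, by simp⟩
  · exact ⟨2, by rw [omega_sq]; push_cast; ring⟩

lemma _root_.InUH2Level.omega_smul {g : Matrix (Fin 2) (Fin 2) ℂ} (hg : InUH2Level g) :
    InUH2Level (omega • g) := by
  obtain ⟨h1, h2, h3⟩ := hg
  refine ⟨fun i j => ?_, ?_, fun i j => ?_⟩
  · exact mul_mem omega_mem (h1 i j)
  · rw [conjTranspose_smul, smul_mul_assoc, smul_mul_assoc, mul_smul_comm, smul_smul,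
      star_omega_mul_omega, one_smul, h2]
  · obtain ⟨o, ho, h⟩ := h3 i j
    refine ⟨o + (omega + 1) * g i j, add_mem ho (mul_mem (add_mem omega_mem (one_mem _)) (h1 i j)),
      ?_⟩
    change omega * g i j - _ = sqrtNegThree * _
    change _ = sqrtNegThree * _ at h
    linear_combination h + g i j * (omega + 1) * two_mul_omega - 2 * g i j * omega_sq

lemma _root_.InUH2Level.omega_pow_smul {g : Matrix (Fin 2) (Fin 2) ℂ} (hg : InUH2Level g)
    (n : ℕ) : InUH2Level (omega ^ n • g) := by
  induction n with
  | zero => simpa using hg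
  | succ n ih =>
    rw [pow_succ', mul_smul]
    exact ih.omega_smul

lemma _root_.InUH2Level.exists_det_eq {g : Matrix (Fin 2) (Fin 2) ℂ} (hg : InUH2Level g) :
    ∃ j : ℕ, g.det = omega ^ j := by
  obtain ⟨h1, h2, h3⟩ := hg
  have hdet := congrArg det h2
  rw [det_mul, det_mul, det_conjTranspose] at hdet
  have hH : H2c.det = -1 := by simp [H2c, det_fin_two]
  rw [hH] at hdet
  obtain ⟨a, ha, ha'⟩ := h3 0 0
  obtain ⟨b, hb, hb'⟩ := h3 0 1
  obtain ⟨d, hd, hd'⟩ := h3 1 1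
  simp only [one_apply_eq] at ha' hd'
  rw [one_apply_ne (by decide)] at hb'
  change _ = sqrtNegThree * _ at ha' hb' hd'
  refine eq_omega_pow (o := a * g 1 1 + d - b * g 1 0) ?_ (by linear_combination -hdet)
    (sub_mem (add_mem (mul_mem ha (h1 _ _)) hd) (mul_mem hb (h1 _ _))) ?_
  · rw [det_fin_two]
    exact sub_mem (mul_mem (h1 _ _) (h1 _ _)) (mul_mem (h1 _ _) (h1 _ _))
  · rw [det_fin_two]
    linear_combination g 1 1 * ha' + hd' - g 1 0 * hb'

/-- Conjugation of an integral matrix by `g₀⁻¹`, where `g₀ = diag(1/√−3, 1)`. -/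
def conjDiag (γ : Matrix (Fin 2) (Fin 2) ℤ) : Matrix (Fin 2) (Fin 2) ℂ :=
  !![(γ 0 0 : ℂ), sqrtNegThree * γ 0 1; sqrtNegThree * (-γ 1 0 / 3), γ 1 1]

lemma conjDiag_mul (γ δ : Matrix (Fin 2) (Fin 2) ℤ) :
    conjDiag (γ * δ) = conjDiag γ * conjDiag δ := by
  ext i j
  fin_cases i <;> fin_cases j <;>
    simp only [conjDiag, mul_apply, Fin.sum_univ_two, Fin.isValue, Fin.zero_eta, Fin.mk_one,
      of_apply, cons_val', cons_val_zero, cons_val_one, cons_val_fin_one] <;> push_cast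
  · linear_combination (γ 0 1 * δ 1 0 / 3 : ℂ) * sqrtNegThree_mul_self
  · ring
  · ring
  · linear_combination (γ 1 0 * δ 0 1 / 3 : ℂ) * sqrtNegThree_mul_self

lemma conjDiag_injective : Function.Injective conjDiag := by
  intro γ δ h
  have h00 := congrFun₂ h 0 0
  have h01 := congrFun₂ h 0 1
  have h10 := congrFun₂ h 1 0
  have h11 := congrFun₂ h 1 1
  simp [conjDiag, sqrtNegThree_ne_zero] at h00 h01 h10 h11
  ext i j
  fin_cases i <;> fin_cases j <;> simp [h00, h01, h10, h11]

lemma det_conjDiag (γ : Matrix (Fin 2) (Fin 2) ℤ) : (conjDiag γ).det = (γ.det : ℂ) := by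
  rw [det_fin_two, det_fin_two]
  simp only [conjDiag, of_apply, cons_val', cons_val_zero, cons_val_one, cons_val_fin_one,
    Fin.isValue]
  push_cast
  linear_combination (γ 0 1 * γ 1 0 / 3 : ℂ) * sqrtNegThree_mul_self

lemma mem_Gamma1_three_iff (γ : Matrix.SpecialLinearGroup (Fin 2) ℤ) :
    γ ∈ CongruenceSubgroup.Gamma1 3 ↔
      (3 : ℤ) ∣ γ 0 0 - 1 ∧ (3 : ℤ) ∣ γ 1 1 - 1 ∧ (3 : ℤ) ∣ γ 1 0 := by
  rw [CongruenceSubgroup.Gamma1_mem]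
  have key (a : ℤ) : (3 : ℤ) ∣ a ↔ (a : ZMod 3) = 0 := (ZMod.intCast_zmod_eq_zero_iff_dvd a 3).symm
  simp only [key]
  push_cast
  rw [sub_eq_zero, sub_eq_zero]

lemma inUH2Level_conjDiag {γ : Matrix.SpecialLinearGroup (Fin 2) ℤ}
    (hγ : γ ∈ CongruenceSubgroup.Gamma1 3) : InUH2Level (conjDiag γ) := by
  obtain ⟨⟨a, ha⟩, ⟨d, hd⟩, ⟨c, hc⟩⟩ := (mem_Gamma1_three_iff γ).mp hγ
  have hdet : (γ 0 0 * γ 1 1 - γ 0 1 * γ 1 0 : ℂ) = 1 := by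
    have := γ.det_coe
    rw [det_fin_two] at this
    exact_mod_cast this
  have ha : (γ 0 0 : ℂ) = 1 + 3 * a := by
    rw [← sub_eq_iff_eq_add']
    exact_mod_cast ha
  have hd : (γ 1 1 : ℂ) = 1 + 3 * d := by
    rw [← sub_eq_iff_eq_add']
    exact_mod_cast hd
  have hc : (γ 1 0 : ℂ) = 3 * c := by exact_mod_cast hc
  have int_mem (n : ℤ) : (n : ℂ) ∈ EisensteinInt := intCast_mem _ n
  have hc' : -(γ 1 0 : ℂ) / 3 = (-c : ℤ) := by
    rw [hc]
    push_cast
    ring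
  refine ⟨fun i j => ?_, ?_, fun i j => ?_⟩
  · fin_cases i <;> fin_cases j
    · exact int_mem _
    · exact mul_mem sqrtNegThree_mem (int_mem _)
    · change sqrtNegThree * (-(γ 1 0 : ℂ) / 3) ∈ _
      rw [hc']
      exact mul_mem sqrtNegThree_mem (int_mem _)
    · exact int_mem _
  · have hs : (starRingEnd ℂ) sqrtNegThree = -sqrtNegThree := star_sqrtNegThree
    have h3 : (starRingEnd ℂ) 3 = 3 := Complex.conj_ofNat 3
    ext i j
    fin_cases i <;> fin_cases j <;>
      simp [conjDiag, H2c, mul_apply, Fin.sum_univ_two, hs, h3]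
    · ring
    · linear_combination hdet + (γ 0 1 * γ 1 0 / 3 : ℂ) * sqrtNegThree_mul_self
    · linear_combination hdet + (γ 0 1 * γ 1 0 / 3 : ℂ) * sqrtNegThree_mul_self
    · ring
  · change ∃ o ∈ EisensteinInt, _ = sqrtNegThree * o
    fin_cases i <;> fin_cases j
    · refine ⟨-sqrtNegThree * a, mul_mem (neg_mem sqrtNegThree_mem) (int_mem _), ?_⟩
      simp only [conjDiag, Fin.zero_eta, of_apply, cons_val', cons_val_zero, one_apply_eq]
      linear_combination ha + (a : ℂ) * sqrtNegThree_mul_self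
    · exact ⟨γ 0 1, int_mem _, by simp [conjDiag]⟩
    · refine ⟨(-c : ℤ), int_mem _, ?_⟩
      rw [← hc']
      simp [conjDiag]
    · refine ⟨-sqrtNegThree * d, mul_mem (neg_mem sqrtNegThree_mem) (int_mem _), ?_⟩
      change (γ 1 1 : ℂ) - 1 = _
      linear_combination hd + (d : ℂ) * sqrtNegThree_mul_self

lemma exists_conjDiag_eq {g : Matrix (Fin 2) (Fin 2) ℂ} (hg : InUH2Level g) (hdet : g.det = 1) :
    ∃ γ ∈ CongruenceSubgroup.Gamma1 3, conjDiag (γ : Matrix.SpecialLinearGroup (Fin 2) ℤ) = g := by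
  obtain ⟨h1, h2, h3⟩ := hg
  -- In determinant one, `gᴴ H₂ g = H₂` says that `gᴴ = H₂ · adj(g) · H₂`.
  have hstar : gᴴ * H2c = H2c * g.adjugate := by
    conv_rhs => rw [← h2, mul_assoc _ g, mul_adjugate, hdet, one_smul, mul_one]
  rw [adjugate_fin_two] at hstar
  have e00 := congrFun₂ hstar 0 1
  have e01 := congrFun₂ hstar 1 1
  have e10 := congrFun₂ hstar 0 0
  have e11 := congrFun₂ hstar 1 0
  simp only [H2c, mul_apply, Fin.sum_univ_two, conjTranspose_apply, of_apply, cons_val',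
    cons_val_zero, cons_val_one, cons_val_fin_one, Fin.isValue, mul_one, mul_zero, zero_mul,
    one_mul, zero_add, add_zero] at e00 e01 e10 e11
  obtain ⟨oa, hoa, ha⟩ := h3 0 0
  obtain ⟨ob, hob, hb⟩ := h3 0 1
  obtain ⟨oc, hoc, hc⟩ := h3 1 0
  obtain ⟨od, hod, hd⟩ := h3 1 1
  rw [one_apply_eq] at ha hd
  rw [one_apply_ne (by decide), sub_zero] at hb hc
  change _ = sqrtNegThree * _ at ha hb hc hd
  have star_of_imaginary {z o : ℂ} (hz : star z = -z) (ho : z = sqrtNegThree * o) :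
      star o = o := by
    apply mul_left_cancel₀ sqrtNegThree_ne_zero
    rw [← ho, ← neg_eq_iff_eq_neg.mpr hz, ho, star_mul', star_sqrtNegThree]
    ring
  obtain ⟨p, hp⟩ := exists_int_of_mem_of_star_eq (h1 0 0) e00
  obtain ⟨t, ht⟩ := exists_int_of_mem_of_star_eq (h1 1 1) e11
  obtain ⟨q, rfl⟩ := exists_int_of_mem_of_star_eq hob (star_of_imaginary e01 hb)
  obtain ⟨r, rfl⟩ := exists_int_of_mem_of_star_eq hoc (star_of_imaginary e10 hc)
  have hpmod : (p + 0) % 3 = 1 := int_add_emod_three hoa (by rw [← ha, hp]; simp)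
  have htmod : (t + 0) % 3 = 1 := int_add_emod_three hod (by rw [← hd, ht]; simp)
  have hγ : conjDiag !![p, q; -3 * r, t] = g := by
    ext i j
    fin_cases i <;> fin_cases j <;> simp [conjDiag, hp, ht, hb, hc]
  refine ⟨⟨!![p, q; -3 * r, t], ?_⟩, (mem_Gamma1_three_iff _).mpr ⟨?_, ?_, ?_⟩, hγ⟩
  · rw [← hγ, det_conjDiag] at hdet
    exact_mod_cast hdet
  · change (3 : ℤ) ∣ p - 1
    lia
  · change (3 : ℤ) ∣ t - 1
    lia
  · change (3 : ℤ) ∣ -3 * r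
    lia

/-- The parametrization of `U(H₂;𝒪)[√−3]` by `Γ₁(3) × C₃`. -/
def param (x : CongruenceSubgroup.Gamma1 3 × Multiplicative (ZMod 3)) :
    Matrix (Fin 2) (Fin 2) ℂ :=
  omega ^ (x.2.toAdd.val) • conjDiag x.1.1

lemma param_mul (x y : CongruenceSubgroup.Gamma1 3 × Multiplicative (ZMod 3)) :
    param (x * y) = param x * param y := by
  simp only [param, Prod.fst_mul, Prod.snd_mul, toAdd_mul, ZMod.val_add, omega_pow_mod, pow_add,
    Subgroup.coe_mul, Matrix.SpecialLinearGroup.coe_mul, conjDiag_mul, smul_mul_smul_comm]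

lemma inUH2Level_param (x : CongruenceSubgroup.Gamma1 3 × Multiplicative (ZMod 3)) :
    InUH2Level (param x) :=
  (inUH2Level_conjDiag x.1.2).omega_pow_smul _

lemma param_injective : Function.Injective param := by
  rintro ⟨γ, k⟩ ⟨δ, l⟩ h
  have hdet (x : CongruenceSubgroup.Gamma1 3 × Multiplicative (ZMod 3)) :
      (param x).det ^ 2 = omega ^ (x.2.toAdd.val) := by
    rw [param, det_smul, Fintype.card_fin, det_conjDiag, Matrix.SpecialLinearGroup.det_coe, Int.cast_one,
      mul_one]
    linear_combination omega ^ x.2.toAdd.val * omega_pow_pow_three x.2.toAdd.val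
  have hpow : omega ^ k.toAdd.val = omega ^ l.toAdd.val := by
    rw [← hdet (γ, k), ← hdet (δ, l), h]
  obtain rfl : k = l := Multiplicative.toAdd.injective <| ZMod.val_injective 3 <|
    isPrimitiveRoot_omega.pow_inj (ZMod.val_lt _) (ZMod.val_lt _) hpow
  have hne : omega ^ k.toAdd.val ≠ 0 :=
    pow_ne_zero _ (isPrimitiveRoot_omega.ne_zero three_ne_zero)
  have := conjDiag_injective (smul_right_injective _ hne h)
  exact Prod.ext (Subtype.ext (Subtype.ext this)) rfl

lemma exists_param_eq {g : Matrix (Fin 2) (Fin 2) ℂ} (hg : InUH2Level g) :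
    ∃ x, param x = g := by
  obtain ⟨j, hj⟩ := hg.exists_det_eq
  have hj3 := omega_pow_pow_three j
  obtain ⟨γ, hγ, h⟩ := exists_conjDiag_eq (hg.omega_pow_smul j) (by
    rw [det_smul, hj, Fintype.card_fin]
    linear_combination hj3)
  refine ⟨(⟨γ, hγ⟩, Multiplicative.ofAdd ((2 * j : ℕ) : ZMod 3)), ?_⟩
  rw [param, toAdd_ofAdd, ZMod.val_natCast, omega_pow_mod, h, smul_smul, ← pow_add]
  rw [show 2 * j + j = j * 3 by ring, pow_mul, hj3, one_smul]

/-- The parametrization as a bijection onto `U(H₂;𝒪)[√−3]`. -/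
def paramEquiv : CongruenceSubgroup.Gamma1 3 × Multiplicative (ZMod 3) ≃
    {g : Matrix (Fin 2) (Fin 2) ℂ // InUH2Level g} :=
  Equiv.ofBijective (fun x => ⟨param x, inUH2Level_param x⟩)
    ⟨fun _ _ h => param_injective (congrArg Subtype.val h),
      fun g => (exists_param_eq g.2).imp fun _ h => Subtype.ext h⟩

lemma param_paramEquiv_symm (g : {g : Matrix (Fin 2) (Fin 2) ℂ // InUH2Level g}) :
    param (paramEquiv.symm g) = g :=
  congrArg Subtype.val (paramEquiv.apply_symm_apply g)

end EisensteinUnitary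

open EisensteinUnitary in
/-- `U(H₂;𝒪)[√−3] ≅ Γ₁(3) × C₃`: there is a multiplicative bijection from the principal
congruence subgroup of level `√−3` of `U(H₂;𝒪)` onto the product of the congruence
subgroup `Γ₁(3) ⊆ SL(2,ℤ)` with a cyclic group of order three. -/
theorem statement14 :
    ∃ f : {g : Matrix (Fin 2) (Fin 2) ℂ // InUH2Level g} →
      (CongruenceSubgroup.Gamma1 3) × Multiplicative (ZMod 3),
      Function.Bijective f ∧
      ∀ (g₁ g₂ : Matrix (Fin 2) (Fin 2) ℂ) (h₁ : InUH2Level g₁) (h₂ : InUH2Level g₂)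
        (h₁₂ : InUH2Level (g₁ * g₂)),
        f ⟨g₁ * g₂, h₁₂⟩ = f ⟨g₁, h₁⟩ * f ⟨g₂, h₂⟩ := by
  refine ⟨paramEquiv.symm, paramEquiv.symm.bijective, fun g₁ g₂ h₁ h₂ h₁₂ => ?_⟩
  apply param_injective
  simp only [param_mul, param_paramEquiv_symm]
end
end

section
/- For every τ in the upper half-plane ℍ, the weight-one Eisenstein series E₁ for Γ₁(3) satisfies the transformation law E₁(−1/(3τ)) = −i√3 · τ · E₁(τ). -/
noncomputable section

/-- The quadratic character mod 3 (Legendre symbol `(d/3)`). -/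
def chi3 (d : ℕ) : ℤ := if d % 3 = 1 then 1 else if d % 3 = 2 then -1 else 0

/-- The weight-one Eisenstein series for `Γ₁(3)`:
`E₁(τ) = 1 + 6·Σ_{n≥1} (Σ_{d ∣ n} χ(d)) qⁿ` with `q = exp(2πiτ)`. -/
def E1 (τ : ℂ) : ℂ :=
  1 + 6 * ∑' n : ℕ, (∑ d ∈ n.divisors, (chi3 d : ℂ)) *
    Complex.exp (2 * Real.pi * Complex.I * τ) ^ n

section

open Complex Filter Asymptotics EisensteinSeries
open UpperHalfPlane hiding I

lemma cot_neg_arg (x : ℂ) : cot (-x) = -cot x := by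
  simp [Complex.cot, div_neg]

lemma linear_int_ne_zero (z : ℍ) {a b : ℤ} (h : a ≠ 0 ∨ b ≠ 0) : (a : ℂ) * z + b ≠ 0 := by
  have := UpperHalfPlane.linear_ne_zero (cd := ![(a : ℝ), (b : ℝ)]) z (by
    intro H
    have h0 := congrFun H 0
    have h1 := congrFun H 1
    simp at h0 h1
    grind)
  simpa using this

lemma linear_add_third_ne_zero (z : ℍ) (a b : ℤ) : (a : ℂ) * z + b + 1 / 3 ≠ 0 := by
  have := linear_int_ne_zero z (a := 3 * a) (b := 3 * b + 1) (by omega)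
  contrapose! this
  push_cast
  linear_combination 3 * this

lemma linear_sub_third_ne_zero (z : ℍ) (a b : ℤ) : (a : ℂ) * z + b - 1 / 3 ≠ 0 := by
  have := linear_add_third_ne_zero z (-a) (-b)
  contrapose! this
  push_cast
  linear_combination -this

/-- The difference of two cotangents as an absolutely convergent sum over `ℤ`. -/
lemma hasSum_cot_sub_cot {u v : ℂ} (hu : u ∈ integerComplement) (hv : v ∈ integerComplement) :
    HasSum (fun n : ℤ ↦ 1 / (u + n) - 1 / (v + n))
      (Real.pi * cot (Real.pi * u) - Real.pi * cot (Real.pi * v)) := by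
  have hs : Summable (fun n : ℤ ↦ 1 / (u + n) - 1 / (v + n)) := by
    have : Summable fun n : ℤ ↦ ((u + n) * (v + n))⁻¹ := by
      apply summable_inv_of_isBigO_rpow_inv (a := 2) (by norm_cast)
      simpa [pow_two] using (linear_inv_isBigO_right 1 v).mul (linear_inv_isBigO_right 1 u)
    refine (this.mul_left (v - u)).congr fun n ↦ ?_
    have h1 := integerComplement_add_ne_zero hu n
    have h2 := integerComplement_add_ne_zero hv n
    field_simp
    ring
  have hc {x : ℂ} (hx : x ∈ integerComplement) :
      Summable fun n : ℕ+ ↦ 1 / (x - n) + 1 / (x + n) := by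
    have := summable_cotTerm hx
    rw [← summable_nat_add_iff (f := fun n : ℕ ↦ 1 / (x - n) + 1 / (x + n)) 1 |>.trans
      summable_pnat_iff_summable_nat.symm]
    simpa [cotTerm] using this
  convert hs.hasSum using 1
  have hp : Summable fun n : ℕ+ ↦ 1 / (u + (n : ℕ)) - 1 / (v + (n : ℕ)) := by
    simpa [Function.comp_def] using hs.comp_injective (i := fun n : ℕ+ ↦ ((n : ℕ) : ℤ))
      (fun a b h ↦ by simpa using h)
  have hm : Summable fun n : ℕ+ ↦ 1 / (u - (n : ℕ)) - 1 / (v - (n : ℕ)) := by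
    simpa [Function.comp_def, sub_eq_add_neg] using
      hs.comp_injective (i := fun n : ℕ+ ↦ -((n : ℕ) : ℤ)) (fun a b h ↦ by simpa using h)
  rw [tsum_int_eq_zero_add_tsum_pnat hs, cot_series_rep hu, cot_series_rep hv, add_sub_add_comm,
    ← (hc hu).tsum_sub (hc hv), add_assoc]
  simp only [Int.cast_zero, add_zero, Int.cast_natCast, Int.cast_neg, ← sub_eq_add_neg]
  rw [← hp.tsum_add hm]
  congr 1
  exact tsum_congr fun n ↦ by ring

/-- The `(m, n)`-term of the weight one series, with the residues `±1/3` paired. -/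
def thirdTerm (z : ℂ) (m n : ℤ) : ℂ := 1 / (m * z + n + 1 / 3) - 1 / (m * z + n - 1 / 3)

/-- The telescoping term whose two iterated sums differ. -/
def stepTerm (z : ℂ) (m n : ℤ) : ℂ := 1 / (m * z + n) - 1 / (m * z + n + 1)

lemma summable_thirdTerm_add_stepTerm (z : ℍ) :
    Summable fun p : ℤ × ℤ ↦ thirdTerm z p.1 p.2 + 2 / 3 * stepTerm z p.1 p.2 := by
  have hinj : Function.Injective (fun m : Fin 2 → ℤ ↦ (3 : ℤ) • m) :=
    smul_right_injective _ (by norm_num)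
  have hthird (b : ℤ) : (fun m : Fin 2 → ℤ ↦ (3 * m 0 * (z : ℂ) + 3 * m 1 + b)⁻¹)
      =O[cofinite] fun m ↦ ‖m‖⁻¹ := by
    have := (isBigO_linear_add_const_vec z 0 b).comp_tendsto hinj.tendsto_cofinite
    simp only [Function.comp_def, Pi.smul_apply, smul_eq_mul, Int.cast_mul, Int.cast_ofNat,
      Int.cast_zero, add_zero] at this
    refine this.trans (IsBigO.of_bound 1 (.of_forall fun m ↦ ?_))
    rw [norm_smul, mul_inv, norm_mul, one_mul]
    refine mul_le_of_le_one_left (norm_nonneg _) ?_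
    norm_num [Int.norm_eq_abs]
  have hlin (b : ℤ) := isBigO_linear_add_const_vec z 0 b
  simp only [Int.cast_zero, add_zero] at hlin
  have h3 : Summable fun m : Fin 2 → ℤ ↦ (3 * m 0 * (z : ℂ) + 3 * m 1 + (1 : ℤ))⁻¹ *
      (3 * m 0 * (z : ℂ) + 3 * m 1 + (-1 : ℤ))⁻¹ * (m 0 * (z : ℂ) + m 1 + (1 : ℤ))⁻¹ := by
    apply summable_of_isBigO_rpow_norm (a := 3) (by norm_num)
    refine (((hthird 1).mul (hthird (-1))).mul (hlin 1)).congr_right fun m ↦ ?_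
    norm_cast
    rw [← mul_inv, ← mul_inv]
    ring
  have h4 : Summable fun m : Fin 2 → ℤ ↦ (3 * m 0 * (z : ℂ) + 3 * m 1 + (1 : ℤ))⁻¹ *
      (3 * m 0 * (z : ℂ) + 3 * m 1 + (-1 : ℤ))⁻¹ * (m 0 * (z : ℂ) + m 1 + (1 : ℤ))⁻¹ *
      (m 0 * (z : ℂ) + m 1 + (0 : ℤ))⁻¹ := by
    apply summable_of_isBigO_rpow_norm (a := 4) (by norm_num)
    refine ((((hthird 1).mul (hthird (-1))).mul (hlin 1)).mul (hlin 0)).congr_right fun m ↦ ?_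
    norm_cast
    rw [← mul_inv, ← mul_inv, ← mul_inv]
    ring
  have h : Summable fun m : Fin 2 → ℤ ↦
      thirdTerm z (m 0) (m 1) + 2 / 3 * stepTerm z (m 0) (m 1) := by
    refine ((h3.mul_left (-6)).add (h4.mul_left (-2 / 3))).congr_cofinite ?_
    filter_upwards [eventually_cofinite_ne ![0, 0], eventually_cofinite_ne ![0, -1]] with m h0 h1
    have e0 : (m 0 : ℂ) * z + m 1 ≠ 0 := by
      apply linear_int_ne_zero
      contrapose! h0
      ext i
      fin_cases i <;> simp [h0]
    have e1 : (m 0 : ℂ) * z + m 1 + 1 ≠ 0 := by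
      have := linear_int_ne_zero z (a := m 0) (b := m 1 + 1) (by
        contrapose! h1
        ext i
        fin_cases i
        · simp [h1]
        · simp; omega)
      simpa [add_assoc] using this
    have e2 := linear_add_third_ne_zero z (m 0) (m 1)
    have e3 := linear_sub_third_ne_zero z (m 0) (m 1)
    simp only [thirdTerm, stepTerm]
    push_cast
    have f2 : 3 * m 0 * (z : ℂ) + 3 * m 1 + 1 = 3 * (m 0 * z + m 1 + 1 / 3) := by ring
    have f3 : 3 * m 0 * (z : ℂ) + 3 * m 1 + -1 = 3 * (m 0 * z + m 1 - 1 / 3) := by ring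
    rw [f2, f3]
    generalize (m 0 : ℂ) * z + m 1 = w at *
    generalize ha : w + 1 / 3 = a at *
    generalize hb : w - 1 / 3 = b at *
    generalize hc : w + 1 = c at *
    rw [add_zero]
    field_simp
    subst ha hb hc
    ring
  exact (finTwoArrowEquiv _).symm.summable_iff.mpr h |>.congr fun p ↦ by simp

lemma norm_chi3_le_one (d : ℕ) : ‖(chi3 d : ℂ)‖ ≤ 1 := by
  unfold chi3
  split_ifs <;> simp

lemma summable_chi3_mul_pow {q : ℂ} (hq : ‖q‖ < 1) :
    Summable fun p : ℕ+ × ℕ+ ↦ (chi3 p.2 : ℂ) * q ^ (p.1 * p.2 : ℕ) := by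
  refine Summable.of_norm_bounded (summable_prod_mul_pow 0 hq).norm fun p ↦ ?_
  rw [norm_mul, norm_mul]
  gcongr
  simpa using norm_chi3_le_one p.2

lemma tsum_chi3_divisors_mul_pow {q : ℂ} (hq : ‖q‖ < 1) :
    ∑' n : ℕ, (∑ d ∈ n.divisors, (chi3 d : ℂ)) * q ^ n =
      ∑' p : ℕ+ × ℕ+, (chi3 p.2 : ℂ) * q ^ (p.1 * p.2 : ℕ) := by
  rw [← PNat.coe_injective.tsum_eq]
  · have hs := summable_chi3_mul_pow hq
    rw [← sigmaAntidiagonalEquivProd.summable_iff] at hs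
    rw [← sigmaAntidiagonalEquivProd.tsum_eq, Summable.tsum_sigma (by exact hs)]
    refine tsum_congr fun n ↦ ?_
    rw [tsum_fintype, Finset.sum_mul]
    simp only [sigmaAntidiagonalEquivProd, divisorsAntidiagonalFactors, PNat.mk_coe,
      Equiv.coe_fn_mk, Finset.univ_eq_attach]
    rw [(n : ℕ).divisorsAntidiagonal.sum_attach
      fun x : ℕ × ℕ ↦ (chi3 x.2 : ℂ) * q ^ (x.1 * x.2),
      Nat.sum_divisorsAntidiagonal' fun x y ↦ (chi3 y : ℂ) * q ^ (x * y)]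
    refine Finset.sum_congr rfl fun d hd ↦ ?_
    rw [Nat.div_mul_cancel (Nat.dvd_of_mem_divisors hd)]
  · intro n hn
    have : n ≠ 0 := by
      rintro rfl
      simp at hn
    exact ⟨⟨n, Nat.pos_of_ne_zero this⟩, rfl⟩

lemma E1_eq_one_add_tsum_prod (z : ℍ) : E1 z =
    1 + 6 * ∑' p : ℕ+ × ℕ+, (chi3 p.2 : ℂ) * cexp (2 * Real.pi * I * z) ^ (p.1 * p.2 : ℕ) := by
  rw [E1, tsum_chi3_divisors_mul_pow (UpperHalfPlane.norm_exp_two_pi_I_lt_one z)]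

lemma summable_pnat_pow {q : ℂ} (hq : ‖q‖ < 1) : Summable fun n : ℕ+ ↦ q ^ (n : ℕ) :=
  summable_pnat_iff_summable_nat.mpr (summable_geometric_of_norm_lt_one hq)

lemma tsum_pow_eq_one_add_tsum_pnat {q : ℂ} (hq : ‖q‖ < 1) :
    ∑' n : ℕ, q ^ n = 1 + ∑' n : ℕ+, q ^ (n : ℕ) := by
  rw [← tsum_zero_pnat_eq_tsum_nat (summable_geometric_of_norm_lt_one hq :), pow_zero]

lemma pi_mul_cot_eq_tsum_pnat {x : ℂ} (hx : 0 < x.im) : Real.pi * cot (Real.pi * x) =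
    -(Real.pi * I) - 2 * Real.pi * I * ∑' n : ℕ+, cexp (2 * Real.pi * I * x) ^ (n : ℕ) := by
  obtain ⟨z, rfl⟩ : ∃ z : ℍ, (z : ℂ) = x := ⟨⟨x, hx⟩, rfl⟩
  have h := tsum_pow_eq_one_add_tsum_pnat z.norm_exp_two_pi_I_lt_one
  rw [pi_mul_cot_pi_q_exp, h]
  ring

lemma hasSum_int_of_even {f : ℤ → ℂ} (hf : Function.Even f)
    (hs : Summable fun n : ℕ+ ↦ f (n : ℕ)) : HasSum f (f 0 + 2 * ∑' n : ℕ+, f (n : ℕ)) := by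
  have hn : Summable fun n : ℕ ↦ f n :=
    (summable_pnat_iff_summable_nat (f := fun n : ℕ ↦ f n)).mp hs
  have h : Summable f := Summable.of_nat_of_neg hn (by simpa [hf _] using hn)
  rw [h.hasSum_iff, tsum_int_eq_zero_add_two_mul_tsum_pnat hf h, two_nsmul, two_mul]

lemma mem_integerComplement_of_im_ne_zero {x : ℂ} (hx : x.im ≠ 0) : x ∈ integerComplement := by
  rw [mem_integerComplement_iff]
  rintro ⟨n, rfl⟩
  simp at hx

lemma linear_add_third_mem_integerComplement (z : ℍ) (m : ℤ) :
    (m : ℂ) * z + 1 / 3 ∈ integerComplement := by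
  rw [mem_integerComplement_iff]
  rintro ⟨n, hn⟩
  apply linear_add_third_ne_zero z m (-n)
  push_cast
  linear_combination -hn

lemma linear_sub_third_mem_integerComplement (z : ℍ) (m : ℤ) :
    (m : ℂ) * z - 1 / 3 ∈ integerComplement := by
  rw [mem_integerComplement_iff]
  rintro ⟨n, hn⟩
  apply linear_sub_third_ne_zero z m (-n)
  push_cast
  linear_combination -hn

lemma hasSum_thirdTerm_right (z : ℍ) (m : ℤ) : HasSum (thirdTerm z m)
    (Real.pi * cot (Real.pi * (m * z + 1 / 3)) - Real.pi * cot (Real.pi * (m * z - 1 / 3))) := by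
  refine (hasSum_cot_sub_cot (linear_add_third_mem_integerComplement z m)
    (linear_sub_third_mem_integerComplement z m)).congr_fun fun n ↦ ?_
  rw [thirdTerm, add_right_comm, sub_add_eq_add_sub]

lemma im_neg_one_div_three_mul_pos (z : ℍ) : 0 < (-1 / (3 * (z : ℂ))).im := by
  have h : -1 / (3 * (z : ℂ)) = ((1 / 3 : ℝ) : ℂ) * (-(z : ℂ))⁻¹ := by
    have := z.ne_zero
    push_cast
    field_simp
  rw [h, im_ofReal_mul]
  exact mul_pos (by norm_num) z.im_inv_neg_coe_pos

lemma hasSum_thirdTerm_left (z : ℍ) (n : ℤ) : HasSum (fun m ↦ thirdTerm z m n)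
    (1 / z * (Real.pi * cot (Real.pi * ((n + 1 / 3) / z)) -
      Real.pi * cot (Real.pi * ((n - 1 / 3) / z)))) := by
  have hz : (z : ℂ) ≠ 0 := z.ne_zero
  have hu : ((n : ℂ) + 1 / 3) / z ∈ integerComplement := by
    rw [mem_integerComplement_iff]
    rintro ⟨m, hm⟩
    apply linear_add_third_ne_zero z (-m) n
    rw [eq_div_iff hz] at hm
    push_cast
    linear_combination -hm
  have hv : ((n : ℂ) - 1 / 3) / z ∈ integerComplement := by
    rw [mem_integerComplement_iff]
    rintro ⟨m, hm⟩
    apply linear_sub_third_ne_zero z (-m) n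
    rw [eq_div_iff hz] at hm
    push_cast
    linear_combination -hm
  refine ((hasSum_cot_sub_cot hu hv).mul_left (1 / (z : ℂ))).congr_fun fun m ↦ ?_
  have h2 := linear_add_third_ne_zero z m n
  have h3 := linear_sub_third_ne_zero z m n
  have e2 : ((n : ℂ) + 1 / 3) / z + m = (m * z + n + 1 / 3) / z := by field_simp; ring
  have e3 : ((n : ℂ) - 1 / 3) / z + m = (m * z + n - 1 / 3) / z := by field_simp; ring
  rw [e2, e3, thirdTerm]
  field_simp

lemma sq_ofReal_sqrt_three : (Real.sqrt 3 : ℂ) ^ 2 = 3 := by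
  norm_cast
  exact Real.sq_sqrt (by norm_num)

lemma ofReal_sqrt_three_ne_zero : (Real.sqrt 3 : ℂ) ≠ 0 := by
  simp

lemma cexp_third_pow_sub (k : ℕ) :
    cexp (2 * Real.pi * I * (1 / 3)) ^ k - cexp (2 * Real.pi * I * (-1 / 3)) ^ k =
      I * (Real.sqrt 3 : ℂ) * chi3 k := by
  have h1 : cexp (2 * Real.pi * I * (1 / 3)) = -1 / 2 + (Real.sqrt 3 : ℂ) / 2 * I := by
    have : 2 * Real.pi * I * (1 / 3) = ((Real.pi - Real.pi / 3 : ℝ) : ℂ) * I := by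
      push_cast
      ring
    rw [this, Complex.exp_mul_I, ← ofReal_cos, ← ofReal_sin, Real.cos_pi_sub, Real.sin_pi_sub,
      Real.cos_pi_div_three, Real.sin_pi_div_three]
    push_cast
    ring
  have h2 : cexp (2 * Real.pi * I * (-1 / 3)) = -1 / 2 - (Real.sqrt 3 : ℂ) / 2 * I := by
    have : 2 * Real.pi * I * (-1 / 3) = ((Real.pi / 3 - Real.pi : ℝ) : ℂ) * I := by
      push_cast
      ring
    rw [this, Complex.exp_mul_I, ← ofReal_cos, ← ofReal_sin, Real.cos_sub_pi, Real.sin_sub_pi,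
      Real.cos_pi_div_three, Real.sin_pi_div_three]
    push_cast
    ring
  have hs := sq_ofReal_sqrt_three
  have c1 : cexp (2 * Real.pi * I * (1 / 3)) ^ 3 = 1 := by
    rw [← Complex.exp_nat_mul, Complex.exp_eq_one_iff]
    exact ⟨1, by push_cast; ring⟩
  have c2 : cexp (2 * Real.pi * I * (-1 / 3)) ^ 3 = 1 := by
    rw [← Complex.exp_nat_mul, Complex.exp_eq_one_iff]
    exact ⟨-1, by push_cast; ring⟩
  have hk := Nat.div_add_mod k 3
  rw [← hk, pow_add, pow_add, pow_mul, pow_mul, c1, c2, h1, h2]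
  have : k % 3 < 3 := Nat.mod_lt _ (by norm_num)
  simp only [chi3, Nat.mul_add_mod, Nat.mod_mod]
  interval_cases k % 3 <;> simp <;> ring

/-- The iterated sum over the lattice, rows first. -/
lemma hasSum_tsum_thirdTerm_right (z : ℍ) : HasSum (fun m ↦ ∑' n, thirdTerm z m n)
    (2 * Real.pi / Real.sqrt 3 * E1 z) := by
  set q := cexp (2 * Real.pi * I * z) with hq
  have hq1 : ‖q‖ < 1 := z.norm_exp_two_pi_I_lt_one
  have hs3 := sq_ofReal_sqrt_three
  have hs3' := ofReal_sqrt_three_ne_zero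
  have hsum := (summable_chi3_mul_pow hq1)
  have heven : Function.Even fun m ↦ ∑' n, thirdTerm z m n := by
    intro m
    simp only [(hasSum_thirdTerm_right z _).tsum_eq]
    have e1 : Real.pi * (((-m : ℤ) : ℂ) * z + 1 / 3) = -(Real.pi * (m * (z : ℂ) - 1 / 3)) := by
      push_cast
      ring
    have e2 : Real.pi * (((-m : ℤ) : ℂ) * z - 1 / 3) = -(Real.pi * (m * (z : ℂ) + 1 / 3)) := by
      push_cast
      ring
    rw [e1, e2, cot_neg_arg, cot_neg_arg]
    ring
  have hzero : ∑' n, thirdTerm z 0 n = 2 * Real.pi / Real.sqrt 3 := by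
    have e1 : Real.pi * (((0 : ℤ) : ℂ) * z + 1 / 3) = ((Real.pi / 3 : ℝ) : ℂ) := by
      push_cast
      ring
    have e2 : Real.pi * (((0 : ℤ) : ℂ) * z - 1 / 3) = -((Real.pi / 3 : ℝ) : ℂ) := by
      push_cast
      ring
    rw [(hasSum_thirdTerm_right z 0).tsum_eq, e1, e2, cot_neg_arg, Complex.cot, ← ofReal_cos,
      ← ofReal_sin, Real.cos_pi_div_three, Real.sin_pi_div_three]
    push_cast
    field_simp
    ring
  have hpos (m : ℕ+) : ∑' n, thirdTerm z (m : ℕ) n =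
      2 * Real.pi * Real.sqrt 3 * ∑' k : ℕ+, (chi3 k : ℂ) * q ^ (m * k : ℕ) := by
    have him : 0 < ((m : ℂ) * z).im := by
      have : 0 < (m : ℝ) * z.im := mul_pos (by exact_mod_cast m.pos) z.im_pos
      simpa using this
    have him1 : 0 < ((m : ℂ) * z + 1 / 3).im := by simpa using him
    have him2 : 0 < ((m : ℂ) * z - 1 / 3).im := by simpa using him
    have hn1 := UpperHalfPlane.norm_exp_two_pi_I_lt_one ⟨_, him1⟩
    have hn2 := UpperHalfPlane.norm_exp_two_pi_I_lt_one ⟨_, him2⟩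
    have f1 : cexp (2 * Real.pi * I * ((m : ℂ) * z + 1 / 3)) =
        q ^ (m : ℕ) * cexp (2 * Real.pi * I * (1 / 3)) := by
      rw [hq, ← Complex.exp_nat_mul, ← Complex.exp_add]
      ring_nf
    have f2 : cexp (2 * Real.pi * I * ((m : ℂ) * z - 1 / 3)) =
        q ^ (m : ℕ) * cexp (2 * Real.pi * I * (-1 / 3)) := by
      rw [hq, ← Complex.exp_nat_mul, ← Complex.exp_add]
      ring_nf
    rw [(hasSum_thirdTerm_right z _).tsum_eq, Int.cast_natCast, pi_mul_cot_eq_tsum_pnat him1,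
      pi_mul_cot_eq_tsum_pnat him2, sub_sub_sub_cancel_left, ← mul_sub,
      ← (summable_pnat_pow hn2).tsum_sub (summable_pnat_pow hn1), ← tsum_mul_left,
      ← tsum_mul_left]
    refine tsum_congr fun k ↦ ?_
    dsimp only
    rw [f1, f2, mul_pow, mul_pow, ← mul_sub, ← neg_sub, cexp_third_pow_sub, pow_mul]
    linear_combination -2 * Real.pi * (q ^ (m : ℕ)) ^ (k : ℕ) * Real.sqrt 3 * chi3 k * I_sq
  have hsm : Summable fun m : ℕ+ ↦ ∑' n, thirdTerm z (m : ℕ) n := by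
    simp only [hpos]
    exact hsum.prod.mul_left _
  convert hasSum_int_of_even heven hsm using 1
  simp only [hpos]
  rw [hzero, E1_eq_one_add_tsum_prod, hsum.tsum_prod, tsum_mul_left]
  field_simp
  linear_combination (-2 : ℂ) * (∑' (m : ℕ+) (k : ℕ+), (chi3 k : ℂ) * q ^ (m * k : ℕ)) * hs3

lemma chi3_three_mul (n : ℕ) : chi3 (3 * n) = 0 := by
  simp [chi3]

lemma chi3_one_add_three_mul (n : ℕ) : chi3 (1 + 3 * n) = 1 := by
  simp [chi3]

lemma chi3_two_add_three_mul (n : ℕ) : chi3 (2 + 3 * n) = -1 := by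
  simp [chi3]

/-- Grouping a series twisted by the character mod 3 into consecutive residue classes. -/
lemma hasSum_chi3_mul_sub {g : ℕ → ℂ} (hg : Summable fun k : ℕ+ ↦ (chi3 k : ℂ) * g k) :
    HasSum (fun n : ℕ+ ↦ g (3 * n + 1) - g (3 * n - 1))
      (∑' k : ℕ+, (chi3 k : ℂ) * g k - g 1) := by
  set F : ℕ → ℂ := fun k ↦ (chi3 k : ℂ) * g k with hF
  have hFs : Summable F := (summable_pnat_iff_summable_nat (f := F)).mp hg
  have h1 : Summable fun n : ℕ ↦ F (1 + 3 * n) :=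
    hFs.comp_injective fun a b h ↦ by simpa using h
  have h2 : Summable fun n : ℕ ↦ F (2 + 3 * n) :=
    hFs.comp_injective fun a b h ↦ by simpa using h
  have h1' := (summable_nat_add_iff 1).mpr h1
  have key : ∑' k : ℕ+, F k = ∑' n : ℕ, F (1 + 3 * n) + ∑' n : ℕ, F (2 + 3 * n) := by
    have h0 := tsum_zero_pnat_eq_tsum_nat hFs
    have hr := Nat.sumByResidueClasses hFs 3
    rw [← h0, show F 0 = 0 by simp [hF, chi3], zero_add] at hr
    rw [hr]
    change ∑ j : Fin 3, ∑' m : ℕ, F ((j : ℕ) + 3 * m) = _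
    rw [Fin.sum_univ_three]
    have : ∑' m : ℕ, F (((0 : Fin 3) : ℕ) + 3 * m) = 0 := by
      simp [hF, chi3_three_mul]
    rw [this, zero_add]
    rfl
  have hsucc : (fun n : ℕ+ ↦ g (3 * n + 1) - g (3 * n - 1)) ∘ Equiv.pnatEquivNat.symm =
      fun n : ℕ ↦ F (1 + 3 * (n + 1)) + F (2 + 3 * n) := by
    ext n
    simp only [Function.comp_apply, hF, chi3_one_add_three_mul, chi3_two_add_three_mul,
      Equiv.pnatEquivNat_symm_apply, Nat.succPNat_coe, Nat.succ_eq_add_one]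
    rw [show 3 * (n + 1) - 1 = 2 + 3 * n by omega, add_comm (3 * (n + 1))]
    push_cast
    ring
  rw [← Equiv.pnatEquivNat.symm.hasSum_iff, hsucc]
  have hval : ∑' k : ℕ+, (chi3 k : ℂ) * g k - g 1 =
      ∑' n : ℕ, F (1 + 3 * (n + 1)) + ∑' n : ℕ, F (2 + 3 * n) := by
    have hF1 : F (1 + 3 * 0) = g 1 := by simp [hF, show chi3 1 = 1 from rfl]
    rw [key, h1.tsum_eq_zero_add, hF1]
    ring
  rw [hval]
  exact h1'.hasSum.add h2.hasSum

lemma summable_chi3_mul_pow_swap {q : ℂ} (hq : ‖q‖ < 1) :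
    Summable fun p : ℕ+ × ℕ+ ↦ (chi3 p.1 : ℂ) * q ^ (p.2 * p.1 : ℕ) :=
  (summable_chi3_mul_pow hq).prod_symm

lemma tsum_chi3_mul_tsum_pow {q : ℂ} (hq : ‖q‖ < 1) :
    ∑' k : ℕ+, (chi3 k : ℂ) * ∑' m : ℕ+, q ^ (m * k : ℕ) =
      ∑' p : ℕ+ × ℕ+, (chi3 p.2 : ℂ) * q ^ (p.1 * p.2 : ℕ) := by
  rw [← (Equiv.prodComm ℕ+ ℕ+).tsum_eq]
  simp only [Equiv.prodComm_apply, Prod.fst_swap, Prod.snd_swap]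
  rw [(summable_chi3_mul_pow_swap hq).tsum_prod]
  simp only [tsum_mul_left]

/-- The iterated sum over the lattice, columns first. -/
lemma hasSum_tsum_thirdTerm_left (z : ℍ) : HasSum (fun n ↦ ∑' m, thirdTerm z m n)
    (2 * Real.pi * I / z * ((2 + E1 (-1 / (3 * z))) / 3)) := by
  have hz : (z : ℂ) ≠ 0 := z.ne_zero
  obtain ⟨w, hw⟩ : ∃ w : ℍ, (w : ℂ) = -1 / (3 * z) := ⟨⟨_, im_neg_one_div_three_mul_pos z⟩, rfl⟩
  set q := cexp (2 * Real.pi * I * w) with hq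
  have hq1 : ‖q‖ < 1 := w.norm_exp_two_pi_I_lt_one
  set g : ℕ → ℂ := fun k ↦ ∑' m : ℕ+, q ^ (m * k : ℕ) with hg
  have hgs : Summable fun k : ℕ+ ↦ (chi3 k : ℂ) * g k := by
    simpa only [hg, tsum_mul_left] using (summable_chi3_mul_pow_swap hq1).prod
  have hgt := tsum_chi3_mul_tsum_pow hq1
  have hcol (n : ℤ) : ∑' m, thirdTerm z m n = 1 / z *
      (Real.pi * cot (Real.pi * ((3 * n - 1) * w)) -
        Real.pi * cot (Real.pi * ((3 * n + 1) * w))) := by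
    have e1 : Real.pi * (((n : ℂ) + 1 / 3) / z) = -(Real.pi * ((3 * n + 1) * w)) := by
      rw [hw]
      field_simp
    have e2 : Real.pi * (((n : ℂ) - 1 / 3) / z) = -(Real.pi * ((3 * n - 1) * w)) := by
      rw [hw]
      field_simp
    rw [(hasSum_thirdTerm_left z n).tsum_eq, e1, e2, cot_neg_arg, cot_neg_arg]
    ring
  have hcot {k : ℕ} (hk : 0 < k) : Real.pi * cot (Real.pi * (k * w)) =
      -(Real.pi * I) - 2 * Real.pi * I * g k := by
    have him : 0 < ((k : ℂ) * w).im := by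
      have : 0 < (k : ℝ) * w.im := mul_pos (by exact_mod_cast hk) w.im_pos
      simpa using this
    rw [pi_mul_cot_eq_tsum_pnat him]
    congr 2
    refine tsum_congr fun m ↦ ?_
    rw [hq, ← Complex.exp_nat_mul, ← Complex.exp_nat_mul]
    congr 1
    push_cast
    ring
  have heven : Function.Even fun n ↦ ∑' m, thirdTerm z m n := by
    intro n
    simp only [hcol]
    have e1 : Real.pi * ((3 * ((-n : ℤ) : ℂ) - 1) * w) = -(Real.pi * ((3 * n + 1) * w)) := by
      push_cast
      ring
    have e2 : Real.pi * ((3 * ((-n : ℤ) : ℂ) + 1) * w) = -(Real.pi * ((3 * n - 1) * w)) := by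
      push_cast
      ring
    rw [e1, e2, cot_neg_arg, cot_neg_arg]
    ring
  have hzero : ∑' m, thirdTerm z m 0 = 1 / z * (2 * Real.pi * I + 4 * Real.pi * I * g 1) := by
    have e1 : Real.pi * ((3 * ((0 : ℤ) : ℂ) - 1) * w) = -(Real.pi * ((1 : ℕ) * w)) := by
      push_cast
      ring
    have e2 : Real.pi * ((3 * ((0 : ℤ) : ℂ) + 1) * w) = Real.pi * ((1 : ℕ) * w) := by
      push_cast
      ring
    rw [hcol, e1, e2, cot_neg_arg, mul_neg, hcot one_pos]
    ring
  have hpos (n : ℕ+) : ∑' m, thirdTerm z m (n : ℕ) =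
      1 / z * (2 * Real.pi * I) * (g (3 * n + 1) - g (3 * n - 1)) := by
    have hn := n.pos
    have e1 : 3 * (((n : ℕ) : ℤ) : ℂ) - 1 = ((3 * n - 1 : ℕ) : ℂ) := by
      rw [Nat.cast_sub (by omega)]
      push_cast
      ring
    have e2 : 3 * (((n : ℕ) : ℤ) : ℂ) + 1 = ((3 * n + 1 : ℕ) : ℂ) := by
      push_cast
      ring
    rw [hcol, e1, e2, hcot (by omega), hcot (by omega)]
    ring
  have hpair := hasSum_chi3_mul_sub hgs
  convert hasSum_int_of_even heven (by simpa only [hpos] using hpair.summable.mul_left _) using 1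
  simp only [hpos]
  rw [hzero, tsum_mul_left, hpair.tsum_eq, hgt, ← hw, E1_eq_one_add_tsum_prod]
  ring

lemma tsum_stepTerm_right (z : ℍ) (m : ℤ) : ∑' n, stepTerm z m n = 0 := by
  rw [← tsum_symmetricIco_linear_sub_linear_add_one_eq_zero z m]
  exact (tsum_eq_of_summable_unconditional (L := SummationFilter.symmetricIco ℤ)
    (summable_right_one_div_linear_sub_one_div_linear_succ z m)).symm

lemma tsum_symmetricIco_tsum_stepTerm (z : ℍ) :
    ∑'[SummationFilter.symmetricIco ℤ] n : ℤ, ∑' m, stepTerm z m n = -2 * Real.pi * I / z := by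
  rw [← tsum_symmetricIco_tsum_sub_eq z]
  rfl

lemma summable_stepTerm_right (z : ℍ) (m : ℤ) : Summable fun n ↦ stepTerm z m n :=
  summable_right_one_div_linear_sub_one_div_linear_succ z m

lemma summable_stepTerm_left (z : ℍ) (n : ℤ) : Summable fun m ↦ stepTerm z m n := by
  refine (summable_left_one_div_linear_sub_one_div_linear z n (n + 1)).congr fun m ↦ ?_
  rw [stepTerm]
  push_cast
  rw [add_assoc]

/-- The functional equation for a point of `ℍ`. -/
lemma E1_neg_one_div_three_mul (z : ℍ) :
    2 * Real.pi / Real.sqrt 3 * E1 z = 2 * Real.pi * I / (3 * z) * E1 (-1 / (3 * z)) := by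
  have hz : (z : ℂ) ≠ 0 := z.ne_zero
  have hs := summable_thirdTerm_add_stepTerm z
  have hrow (m : ℤ) : ∑' n, (thirdTerm z m n + 2 / 3 * stepTerm z m n) = ∑' n, thirdTerm z m n := by
    rw [(hasSum_thirdTerm_right z m).summable.tsum_add ((summable_stepTerm_right z m).mul_left _),
      tsum_mul_left, tsum_stepTerm_right, mul_zero, add_zero]
  have hcol (n : ℤ) : ∑' m, (thirdTerm z m n + 2 / 3 * stepTerm z m n) =
      ∑' m, thirdTerm z m n + 2 / 3 * ∑' m, stepTerm z m n := by
    rw [(hasSum_thirdTerm_left z n).summable.tsum_add ((summable_stepTerm_left z n).mul_left _),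
      tsum_mul_left]
  have hcols : Summable fun n ↦ ∑' m, (thirdTerm z m n + 2 / 3 * stepTerm z m n) :=
    hs.prod_symm.prod
  have hstep : Summable fun n ↦ ∑' m, stepTerm z m n := by
    refine ((hcols.sub (hasSum_tsum_thirdTerm_left z).summable).mul_left (3 / 2)).congr fun n ↦ ?_
    rw [hcol]
    ring
  have hval : ∑' n, ∑' m, stepTerm z m n = -2 * Real.pi * I / z := by
    rw [← tsum_symmetricIco_tsum_stepTerm z,
      tsum_eq_of_summable_unconditional (L := SummationFilter.symmetricIco ℤ) hstep]
  have hswap := Summable.tsum_comm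
    (f := fun m n ↦ thirdTerm z m n + 2 / 3 * stepTerm z m n) hs
  simp only [hrow, hcol] at hswap
  rw [(hasSum_tsum_thirdTerm_left z).summable.tsum_add (hstep.mul_left _), tsum_mul_left, hval,
    (hasSum_tsum_thirdTerm_left z).tsum_eq, (hasSum_tsum_thirdTerm_right z).tsum_eq] at hswap
  rw [← hswap]
  field_simp
  ring

end

/-- The transformation law `E₁(−1/(3τ)) = −i√3·τ·E₁(τ)` for `τ` in the upper
half-plane. -/
theorem statement15 (τ : ℂ) (hτ : 0 < τ.im) :
    E1 (-1 / (3 * τ)) = -(Complex.I * (Real.sqrt 3 : ℂ)) * τ * E1 τ := by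
  obtain ⟨z, rfl⟩ : ∃ z : UpperHalfPlane, (z : ℂ) = τ := ⟨⟨τ, hτ⟩, rfl⟩
  have hz : (z : ℂ) ≠ 0 := z.ne_zero
  have hs := sq_ofReal_sqrt_three
  have hs' := ofReal_sqrt_three_ne_zero
  have hpi : (Real.pi : ℂ) ≠ 0 := by exact_mod_cast Real.pi_ne_zero
  have hc : 2 * Real.pi * Complex.I / (3 * (z : ℂ)) ≠ 0 := by simp [hz, hpi]
  apply mul_left_cancel₀ hc
  rw [← E1_neg_one_div_three_mul z]
  field_simp
  rw [hs, Complex.I_sq]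
  ring
end
end
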